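/- The inequality −3J + 2α ≤ U(c,n₁,n₂,n₃) holds for all c, n₁, n₂, n₃ ∈ {0,1,2} if and only if J ≥ 0 and α ≤ 0. (That is, the value U₁₅ = −3J + 2α is the minimal possible unit-ball energy exactly on the set A₁₅ = {(J,α) : J ≥ 0, α ≤ 0}.) -/

import Mathlib

/-- Unit-ball energy of the SOS model on the Cayley tree of order 2 with spin values
`{0,1,2}`, coupling `J` and translation-invariant external field `α`: for center spin
`c` and neighbor spins `n₁, n₂, n₃`,
`U(c,n₁,n₂,n₃) = -(J/2)·(|c−n₁| + |c−n₂| + |c−n₃|) + α·c`. -/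
noncomputable def ballEnergy (J α : ℝ) (c n₁ n₂ n₃ : Fin 3) : ℝ :=
  -(J / 2) * (|((c : ℕ) : ℝ) - ((n₁ : ℕ) : ℝ)| + |((c : ℕ) : ℝ) - ((n₂ : ℕ) : ℝ)|
      + |((c : ℕ) : ℝ) - ((n₃ : ℕ) : ℝ)|)
    + α * ((c : ℕ) : ℝ)

/-- The distance between two spins in `{0,1,2}` is at most `2`. -/
lemma abs_spin_sub_le_two (a b : Fin 3) : |((a : ℕ) : ℝ) - ((b : ℕ) : ℝ)| ≤ 2 := by
  have spin_le_two (i : Fin 3) : ((i : ℕ) : ℝ) ≤ 2 := by exact_mod_cast i.is_le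
  have ha : (0 : ℝ) ≤ ((a : ℕ) : ℝ) := Nat.cast_nonneg _
  have hb : (0 : ℝ) ≤ ((b : ℕ) : ℝ) := Nat.cast_nonneg _
  rw [abs_le]
  constructor <;> linarith [spin_le_two a, spin_le_two b]

/-- `U₁₅ = −3J + 2α` is the minimal unit-ball energy exactly when `J ≥ 0` and `α ≤ 0`. -/
theorem neg_three_J_add_two_alpha_min_iff (J α : ℝ) :
    (∀ c n₁ n₂ n₃ : Fin 3, -3*J + 2*α ≤ ballEnergy J α c n₁ n₂ n₃) ↔
      (0 ≤ J ∧ α ≤ 0) := by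
  constructor
  · intro h
    have h_aligned := h 2 2 2 2
    have h_opposed := h 0 2 2 2
    norm_num [ballEnergy] at h_aligned h_opposed
    constructor <;> linarith
  · rintro ⟨hJ, hα⟩ c n₁ n₂ n₃
    have hc : ((c : ℕ) : ℝ) ≤ 2 := by exact_mod_cast c.is_le
    have h_interaction := mul_le_mul_of_nonneg_left
      (add_le_add_three (abs_spin_sub_le_two c n₁) (abs_spin_sub_le_two c n₂)
        (abs_spin_sub_le_two c n₃)) (div_nonneg hJ zero_le_two)
    have h_field := mul_le_mul_of_nonpos_left hc hα
    unfold ballEnergy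
    linarith
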